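/- For B > 0 and L > 0 with BL² ≥ 8, let P^L_B(a,b) = Σ_{m∈ℤ} K_B((a₁, a₂ − mL), b) where K_B((x,y),(x',y')) = (B/(2π))·exp(−(B/4)((x−x')² + (y−y')²))·exp(i(B/2)(x+x')(y−y')). Then for every measurable set S ⊆ ℝ × [−L/2, L/2] one has ∫_S ∫_{ℝ×[−L/2,L/2]} |P^L_B(a,b)|² da db ≤ (B/π)·|S|, where |S| is the Lebesgue measure of S. -/

import Mathlib

open MeasureTheory

/-- The integral kernel of the projection onto the lowest Landau level of the Landau
Hamiltonian with magnetic field `B` on the plane `ℝ²`, in the Landau gauge. -/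
noncomputable def landauKernel (B : ℝ) (a b : ℝ × ℝ) : ℂ :=
  ((B / (2 * Real.pi) : ℝ) : ℂ) *
    Complex.exp (((-(B / 4) * ((a.1 - b.1) ^ 2 + (a.2 - b.2) ^ 2) : ℝ) : ℂ)) *
    Complex.exp (Complex.I * ((B / 2 * (a.1 + b.1) * (a.2 - b.2) : ℝ) : ℂ))

/-- The periodization of the lowest Landau level kernel: the kernel of the projection onto
the first Landau level on the cylinder `ℝ × [-L/2, L/2]` with periodic boundary conditions
in `y`. -/
noncomputable def periodizedKernel (B L : ℝ) (a b : ℝ × ℝ) : ℂ :=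
  ∑' m : ℤ, landauKernel B (a.1, a.2 - m * L) b

/-- Unfolding: the square of a periodization, integrated over one period. -/
lemma setLIntegral_Ioc_tsum_add_zsmul_sq {f : ℝ → ENNReal} (hf : Measurable f) {L : ℝ}
    (hL : 0 < L) (a : ℝ) :
    ∫⁻ s in Set.Ioc a (a + L), (∑' m : ℤ, f (s + m * L)) ^ 2 =
      ∑' m : ℤ, ∫⁻ s, f s * f (s + m * L) := by
  set P : ℝ → ENNReal := fun s => ∑' m : ℤ, f (s + m * L) with hP
  have hPm : Measurable P := Measurable.tsum fun m => hf.comp (measurable_id.add_const _)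
  have hper (n : ℤ) (s : ℝ) : P (s + n * L) = P s := by
    simp only [hP]
    rw [← (Equiv.addLeft n).tsum_eq (fun m : ℤ => f (s + m * L))]
    refine tsum_congr fun m => ?_
    simp only [Equiv.coe_addLeft]
    push_cast
    ring_nf
  have hFm : Measurable fun s => f s * P s := hf.mul hPm
  calc ∫⁻ s in Set.Ioc a (a + L), P s ^ 2
      = ∫⁻ s in Set.Ioc a (a + L), ∑' n : ℤ, f (s + n * L) * P (s + n * L) := by
        refine lintegral_congr fun s => ?_
        simp only [hper, ENNReal.tsum_mul_right, sq]
        rfl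
    _ = ∑' n : ℤ, ∫⁻ s in Set.Ioc a (a + L), f (s + n * L) * P (s + n * L) :=
        lintegral_tsum fun n => (hFm.comp (measurable_id.add_const (n * L))).aemeasurable
    _ = ∑' n : ℤ, ∫⁻ s in Set.Ioc (a + n • L) (a + (n + 1) • L), f s * P s := by
        refine tsum_congr fun n => ?_
        rw [← (measurePreserving_add_right volume (n * L : ℝ)).setLIntegral_comp_preimage
          measurableSet_Ioc hFm]
        congr 2
        ext s
        simp only [Set.mem_preimage, Set.mem_Ioc, zsmul_eq_mul]
        push_cast
        constructor <;> rintro ⟨h₁, h₂⟩ <;> constructor <;> linarith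
    _ = ∫⁻ s, f s * P s := by
        rw [← lintegral_iUnion (fun _ => measurableSet_Ioc)
          (Set.pairwise_disjoint_Ioc_add_zsmul a L), iUnion_Ioc_add_zsmul hL, setLIntegral_univ]
    _ = ∑' m : ℤ, ∫⁻ s, f s * f (s + m * L) := by
        simp only [hP, ← ENNReal.tsum_mul_left]
        exact lintegral_tsum fun m =>
          (hf.mul (hf.comp (measurable_id.add_const (m * L)))).aemeasurable

lemma lintegral_gaussian_sub {b : ℝ} (hb : 0 < b) (t : ℝ) :
    ∫⁻ x : ℝ, ENNReal.ofReal (Real.exp (-b * (x - t) ^ 2)) =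
      ENNReal.ofReal √(Real.pi / b) := by
  rw [lintegral_sub_right_eq_self (fun x => ENNReal.ofReal (Real.exp (-b * x ^ 2))) t,
    ← ofReal_integral_eq_lintegral_ofReal (integrable_exp_neg_mul_sq hb)
      (ae_of_all _ fun x => (Real.exp_pos _).le), integral_gaussian]

lemma exp_neg_succ_sq_le (n : ℕ) :
    Real.exp (-((n : ℝ) + 1) ^ 2) ≤ Real.exp (-1) * Real.exp (-3) ^ n := by
  rw [← Real.exp_nat_mul, ← Real.exp_add]
  have h : (n : ℝ) ≤ (n : ℝ) ^ 2 := by exact_mod_cast Nat.le_self_pow two_ne_zero n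
  exact Real.exp_le_exp.2 (by nlinarith)

lemma summable_exp_neg_succ_sq : Summable fun n : ℕ => Real.exp (-((n : ℝ) + 1) ^ 2) :=
  .of_nonneg_of_le (fun _ => (Real.exp_pos _).le) exp_neg_succ_sq_le
    ((summable_geometric_of_lt_one (Real.exp_pos _).le (by simp)).mul_left _)

lemma tsum_exp_neg_succ_sq_le : ∑' n : ℕ, Real.exp (-((n : ℝ) + 1) ^ 2) ≤ 2 / 5 := by
  have h3 : Real.exp (-3) < 1 := by simp
  refine (summable_exp_neg_succ_sq.tsum_le_tsum exp_neg_succ_sq_le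
    ((summable_geometric_of_lt_one (Real.exp_pos _).le h3).mul_left _)).trans ?_
  rw [tsum_mul_left, tsum_geometric_of_lt_one (Real.exp_pos _).le h3, ← div_eq_mul_inv,
    div_le_iff₀ (by linarith)]
  have h1 : Real.exp (-1) < 0.368 := by linarith [Real.exp_neg_one_lt_d9]
  have h2 : Real.exp (-3) = Real.exp (-1) ^ 3 := by rw [← Real.exp_nat_mul]; norm_num
  have h4 : Real.exp (-1) ^ 3 ≤ 0.368 ^ 3 := by gcongr
  rw [h2]
  norm_num at h1 h4 ⊢
  linarith

lemma summable_int_exp_neg_sq : Summable fun m : ℤ => Real.exp (-(m : ℝ) ^ 2) := by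
  refine Summable.of_add_one_of_neg_add_one ?_ ?_
  · simpa using summable_exp_neg_succ_sq
  · refine summable_exp_neg_succ_sq.congr fun n => ?_
    push_cast
    ring_nf

lemma tsum_int_exp_neg_sq_le : ∑' m : ℤ, Real.exp (-(m : ℝ) ^ 2) ≤ 9 / 5 := by
  have h (n : ℕ) : Real.exp (-((-((n : ℤ) + 1) : ℤ) : ℝ) ^ 2) =
      Real.exp (-((n : ℝ) + 1) ^ 2) := by
    push_cast
    ring_nf
  have h' (n : ℕ) : Real.exp (-(((n : ℤ) + 1 : ℤ) : ℝ) ^ 2) =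
      Real.exp (-((n : ℝ) + 1) ^ 2) := by
    push_cast
    ring_nf
  rw [tsum_of_add_one_of_neg_add_one (by simpa only [h'] using summable_exp_neg_succ_sq)
    (by simpa only [h] using summable_exp_neg_succ_sq)]
  simp only [h, h']
  have := tsum_exp_neg_succ_sq_le
  norm_num
  linarith

lemma norm_landauKernel {B : ℝ} (hB : 0 < B) (a b : ℝ × ℝ) :
    ‖landauKernel B a b‖ =
      B / (2 * Real.pi) * Real.exp (-(B / 4) * ((a.1 - b.1) ^ 2 + (a.2 - b.2) ^ 2)) := by
  rw [landauKernel, norm_mul, norm_mul, mul_comm Complex.I, Complex.norm_exp_ofReal_mul_I,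
    mul_one, Complex.norm_real, ← Complex.ofReal_exp, Complex.norm_real, Real.norm_eq_abs,
    Real.norm_eq_abs, abs_of_pos (by positivity), abs_of_pos (Real.exp_pos _)]

lemma measurable_periodizedKernel (B L : ℝ) (a : ℝ × ℝ) :
    Measurable (periodizedKernel B L a) := by
  refine Measurable.tsum fun m => Continuous.measurable ?_
  unfold landauKernel
  fun_prop

lemma lintegral_gaussian_mul_gaussian {B : ℝ} (hB : 0 < B) (y t : ℝ) :
    ∫⁻ s : ℝ, ENNReal.ofReal (Real.exp (-(B / 4) * (y - s) ^ 2)) *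
        ENNReal.ofReal (Real.exp (-(B / 4) * (y - (s + t)) ^ 2)) =
      ENNReal.ofReal (Real.exp (-(B / 8) * t ^ 2)) * ENNReal.ofReal √(2 * Real.pi / B) := by
  have h : 2 * Real.pi / B = Real.pi / (B / 2) := by field_simp
  rw [h, ← lintegral_gaussian_sub (by positivity : 0 < B / 2) (y - t / 2),
    ← lintegral_const_mul _ (by fun_prop)]
  refine lintegral_congr fun s => ?_
  rw [← ENNReal.ofReal_mul (Real.exp_pos _).le, ← ENNReal.ofReal_mul (Real.exp_pos _).le,
    ← Real.exp_add, ← Real.exp_add]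
  ring_nf

lemma tsum_ofReal_gaussian_le {B L : ℝ} (hBL : 8 ≤ B * L ^ 2) :
    ∑' m : ℤ, ENNReal.ofReal (Real.exp (-(B / 8) * (m * L) ^ 2)) ≤ 2 := by
  calc ∑' m : ℤ, ENNReal.ofReal (Real.exp (-(B / 8) * (m * L) ^ 2))
      ≤ ∑' m : ℤ, ENNReal.ofReal (Real.exp (-(m : ℝ) ^ 2)) := by
        refine ENNReal.tsum_le_tsum fun m => ENNReal.ofReal_le_ofReal (Real.exp_le_exp.2 ?_)
        nlinarith [sq_nonneg (m : ℝ)]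
    _ = ENNReal.ofReal (∑' m : ℤ, Real.exp (-(m : ℝ) ^ 2)) :=
        (ENNReal.ofReal_tsum_of_nonneg (fun _ => (Real.exp_pos _).le)
          summable_int_exp_neg_sq).symm
    _ ≤ 2 := by
        rw [← ENNReal.ofReal_ofNat 2]
        exact ENNReal.ofReal_le_ofReal (by linarith [tsum_int_exp_neg_sq_le])

lemma lintegral_periodizedKernel_sq_le {B L : ℝ} (hB : 0 < B) (hL : 0 < L)
    (hBL : 8 ≤ B * L ^ 2) (a : ℝ × ℝ) :
    ∫⁻ b in Set.univ ×ˢ Set.Icc (-(L / 2)) (L / 2), ‖periodizedKernel B L a b‖ₑ ^ 2 ≤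
      ENNReal.ofReal (B / Real.pi) := by
  set f : ℝ → ENNReal := fun s => ENNReal.ofReal (Real.exp (-(B / 4) * (a.2 - s) ^ 2)) with hf
  have hfm : Measurable f := by fun_prop
  set c := ENNReal.ofReal ((B / (2 * Real.pi)) ^ 2)
  set G : ℝ → ENNReal := fun x => ENNReal.ofReal (Real.exp (-(B / 2) * (x - a.1) ^ 2)) with hG
  have hpt (b : ℝ × ℝ) : ‖periodizedKernel B L a b‖ₑ ^ 2 ≤
      c * (G b.1 * (∑' m : ℤ, f (b.2 + m * L)) ^ 2) := by
    have hk (m : ℤ) : ‖landauKernel B (a.1, a.2 - m * L) b‖ₑ =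
        ENNReal.ofReal (B / (2 * Real.pi)) *
          ENNReal.ofReal (Real.exp (-(B / 4) * (b.1 - a.1) ^ 2)) * f (b.2 + m * L) := by
      rw [← ofReal_norm, norm_landauKernel hB, hf,
        ← ENNReal.ofReal_mul (by positivity), ← ENNReal.ofReal_mul (by positivity), mul_assoc,
        ← Real.exp_add]
      ring_nf
    calc ‖periodizedKernel B L a b‖ₑ ^ 2
        ≤ (∑' m : ℤ, ‖landauKernel B (a.1, a.2 - m * L) b‖ₑ) ^ 2 := by
          gcongr
          exact enorm_tsum_le_tsum_enorm
      _ = c * (G b.1 * (∑' m : ℤ, f (b.2 + m * L)) ^ 2) := by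
          have hGsq : G b.1 = ENNReal.ofReal (Real.exp (-(B / 4) * (b.1 - a.1) ^ 2)) ^ 2 := by
            rw [← ENNReal.ofReal_pow (Real.exp_pos _).le, ← Real.exp_nat_mul, hG]
            push_cast
            ring_nf
          simp only [hk, ENNReal.tsum_mul_left]
          rw [hGsq, mul_pow, mul_pow, mul_assoc, ← ENNReal.ofReal_pow (by positivity)]
  have hfin : c * (ENNReal.ofReal √(2 * Real.pi / B) * (2 * ENNReal.ofReal √(2 * Real.pi / B))) =
      ENNReal.ofReal (B / Real.pi) := by
    rw [← ENNReal.ofReal_ofNat 2, ← ENNReal.ofReal_mul (by positivity),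
      ← ENNReal.ofReal_mul (by positivity), ← ENNReal.ofReal_mul (by positivity)]
    congr 1
    rw [mul_left_comm √_, Real.mul_self_sqrt (by positivity)]
    field_simp
  have hPm : Measurable fun s => (∑' m : ℤ, f (s + m * L)) ^ 2 :=
    (Measurable.tsum fun m => hfm.comp (measurable_id.add_const _)).pow_const 2
  have hGm : Measurable G := by fun_prop
  calc ∫⁻ b in Set.univ ×ˢ Set.Icc (-(L / 2)) (L / 2), ‖periodizedKernel B L a b‖ₑ ^ 2
      ≤ ∫⁻ b in Set.univ ×ˢ Set.Icc (-(L / 2)) (L / 2),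
          c * (G b.1 * (∑' m : ℤ, f (b.2 + m * L)) ^ 2) := lintegral_mono hpt
    _ = c * ((∫⁻ x, G x) *
          ∫⁻ s in Set.Icc (-(L / 2)) (L / 2), (∑' m : ℤ, f (s + m * L)) ^ 2) := by
        have hm : Measurable fun b : ℝ × ℝ => G b.1 * (∑' m : ℤ, f (b.2 + m * L)) ^ 2 :=
          (hGm.comp measurable_fst).mul (hPm.comp measurable_snd)
        rw [lintegral_const_mul _ hm, Measure.volume_eq_prod, ← Measure.prod_restrict,
          lintegral_prod_mul hGm.aemeasurable hPm.aemeasurable, Measure.restrict_univ]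
    _ = c * (ENNReal.ofReal √(2 * Real.pi / B) * ∑' m : ℤ, ∫⁻ s, f s * f (s + m * L)) := by
        rw [lintegral_gaussian_sub (by positivity), setLIntegral_congr Ioc_ae_eq_Icc.symm,
          ← setLIntegral_Ioc_tsum_add_zsmul_sq hfm hL (-(L / 2))]
        congr 3
        · field_simp
        · ring_nf
    _ ≤ c * (ENNReal.ofReal √(2 * Real.pi / B) *
          (2 * ENNReal.ofReal √(2 * Real.pi / B))) := by
        simp only [hf, lintegral_gaussian_mul_gaussian hB, ENNReal.tsum_mul_right]
        gcongr
        exact tsum_ofReal_gaussian_le hBL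
    _ = ENNReal.ofReal (B / Real.pi) := hfin

/-- Close to the diagonal the central term dominates the periodization. -/
lemma le_norm_periodizedKernel {B L : ℝ} (hB : 0 < B) (hL : 0 < L) (hBL : 8 ≤ B * L ^ 2)
    {a b : ℝ × ℝ} (hab : |a.2 - b.2| ≤ L / 4) :
    ‖landauKernel B a b‖ / 5 ≤ ‖periodizedKernel B L a b‖ := by
  set k : ℤ → ℂ := fun m => landauKernel B (a.1, a.2 - m * L) b with hk
  have hk0 : k 0 = landauKernel B a b := by simp [hk]
  have hkm (m : ℤ) : ‖k m‖ ≤ ‖k 0‖ * Real.exp (-(m : ℝ) ^ 2) := by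
    simp only [hk, norm_landauKernel hB]
    rw [mul_assoc, ← Real.exp_add]
    refine mul_le_mul_of_nonneg_left (Real.exp_le_exp.2 ?_) (by positivity)
    have hm : |(m : ℝ)| ≤ (m : ℝ) ^ 2 := by
      rw [← sq_abs]
      exact_mod_cast Int.le_self_sq |m|
    have hmd : (m : ℝ) * (a.2 - b.2) ≤ (m : ℝ) ^ 2 * (L / 4) :=
      (le_abs_self _).trans (by rw [abs_mul]; gcongr)
    have h₁ := mul_le_mul_of_nonneg_left hmd (by positivity : 0 ≤ B * L / 2)
    have h₂ := mul_le_mul_of_nonneg_right hBL (sq_nonneg (m : ℝ))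
    push_cast
    nlinarith
  have hs : Summable fun m : ℤ => ‖k 0‖ * Real.exp (-(m : ℝ) ^ 2) :=
    summable_int_exp_neg_sq.mul_left _
  have hkn : Summable fun m => ‖k m‖ := .of_nonneg_of_le (fun _ => norm_nonneg _) hkm hs
  have hsum : ∑' m, ‖k m‖ ≤ ‖k 0‖ * (9 / 5) := by
    refine (hkn.tsum_le_tsum hkm hs).trans ?_
    rw [tsum_mul_left]
    gcongr
    exact tsum_int_exp_neg_sq_le
  have htail : ‖periodizedKernel B L a b - k 0‖ ≤ ∑' m, ‖k m‖ - ‖k 0‖ := by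
    have h₁ := hkn.of_norm.tsum_eq_add_tsum_ite 0
    have h₂ := hkn.tsum_eq_add_tsum_ite 0
    have hn (m : ℤ) : ‖if m = 0 then 0 else k m‖ = if m = 0 then 0 else ‖k m‖ := by
      split_ifs <;> simp
    rw [h₂, add_sub_cancel_left, show periodizedKernel B L a b = ∑' m, k m from rfl, h₁,
      add_sub_cancel_left]
    simp only [← hn]
    refine norm_tsum_le_tsum_norm (.of_nonneg_of_le (fun _ => norm_nonneg _) (fun m => ?_) hkn)
    split_ifs <;> simp
  have := norm_sub_norm_le (k 0) (periodizedKernel B L a b)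
  rw [norm_sub_rev] at this
  rw [← hk0]
  linarith

lemma exists_pos_le_lintegral_periodizedKernel_sq {B L : ℝ} (hB : 0 < B) (hL : 0 < L)
    (hBL : 8 ≤ B * L ^ 2) :
    ∃ c : ℝ, 0 < c ∧ ∀ a : ℝ × ℝ, a.2 ∈ Set.Icc (-(L / 2)) (L / 2) →
      ENNReal.ofReal c ≤ ∫⁻ b in Set.univ ×ˢ Set.Icc (-(L / 2)) (L / 2),
        ‖periodizedKernel B L a b‖ₑ ^ 2 := by
  set c₀ : ℝ := B / (2 * Real.pi) * Real.exp (-(B / 4) * (1 ^ 2 + (L / 4) ^ 2)) / 5 with hc₀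
  have hc₀pos : 0 < c₀ := by positivity
  refine ⟨c₀ ^ 2 * (L / 4), by positivity, fun a ha => ?_⟩
  obtain ⟨u, hu, hu'⟩ : ∃ u, Set.Icc u (u + L / 4) ⊆ Set.Icc (-(L / 2)) (L / 2) ∧
      ∀ s ∈ Set.Icc u (u + L / 4), |a.2 - s| ≤ L / 4 := by
    rcases le_total a.2 0 with h | h
    · refine ⟨a.2, Set.Icc_subset_Icc ha.1 (by linarith), fun s hs => abs_le.2 ?_⟩
      constructor <;> linarith [hs.1, hs.2]
    · refine ⟨a.2 - L / 4, Set.Icc_subset_Icc (by linarith) (by linarith [ha.2]),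
        fun s hs => abs_le.2 ?_⟩
      constructor <;> linarith [hs.1, hs.2]
  set R := Set.Icc a.1 (a.1 + 1) ×ˢ Set.Icc u (u + L / 4) with hR
  have hpt : ∀ b ∈ R, ENNReal.ofReal (c₀ ^ 2) ≤ ‖periodizedKernel B L a b‖ₑ ^ 2 := by
    intro b hb
    have h₂ := hu' b.2 hb.2
    rw [← ofReal_norm, ← ENNReal.ofReal_pow (norm_nonneg _)]
    refine ENNReal.ofReal_le_ofReal (pow_le_pow_left₀ hc₀pos.le ?_ 2)
    refine le_trans ?_ (le_norm_periodizedKernel hB hL hBL h₂)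
    rw [norm_landauKernel hB, hc₀]
    have h₃ : (a.1 - b.1) ^ 2 ≤ 1 ^ 2 :=
      sq_le_sq' (by linarith [hb.1.2]) (by linarith [hb.1.1])
    have h₄ : (a.2 - b.2) ^ 2 ≤ (L / 4) ^ 2 := sq_le_sq' (abs_le.1 h₂).1 (abs_le.1 h₂).2
    gcongr ?_ * Real.exp ?_ / 5
    nlinarith
  have hvol : volume R = ENNReal.ofReal (L / 4) := by
    rw [hR, Measure.volume_eq_prod, Measure.prod_prod, Real.volume_Icc, Real.volume_Icc]
    simp
  calc ENNReal.ofReal (c₀ ^ 2 * (L / 4)) = ∫⁻ _ in R, ENNReal.ofReal (c₀ ^ 2) := by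
        rw [setLIntegral_const, hvol, ENNReal.ofReal_mul (by positivity)]
    _ ≤ ∫⁻ b in R, ‖periodizedKernel B L a b‖ₑ ^ 2 :=
        setLIntegral_mono' (measurableSet_Icc.prod measurableSet_Icc) hpt
    _ ≤ _ := lintegral_mono_set (Set.prod_mono (Set.subset_univ _) hu)

/-- Hilbert–Schmidt bound for the cut-off Landau projection on the
cylinder: for any measurable `S ⊆ ℝ × [-L/2, L/2]`,
`∫_S ∫ |P^L_B(a,b)|² da db ≤ (B/π)·|S|`. -/
theorem periodizedKernel_hilbert_schmidt_bound (B L : ℝ) (hB : 0 < B) (hL : 0 < L)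
    (hBL : 8 ≤ B * L ^ 2) (S : Set (ℝ × ℝ)) (hSm : MeasurableSet S)
    (hS : S ⊆ Set.univ ×ˢ Set.Icc (-(L / 2)) (L / 2)) :
    (∫ a in S, ∫ b in Set.univ ×ˢ Set.Icc (-(L / 2)) (L / 2),
        ‖periodizedKernel B L a b‖ ^ 2)
      ≤ B / Real.pi * (volume S).toReal := by
  set C : Set (ℝ × ℝ) := Set.univ ×ˢ Set.Icc (-(L / 2)) (L / 2)
  set F : ℝ × ℝ → ℝ := fun a => ∫ b in C, ‖periodizedKernel B L a b‖ ^ 2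
  have hF (a : ℝ × ℝ) : F a = (∫⁻ b in C, ‖periodizedKernel B L a b‖ₑ ^ 2).toReal := by
    simp only [F]
    rw [integral_eq_lintegral_of_nonneg_ae (ae_of_all _ fun b => by positivity)
      ((measurable_periodizedKernel B L a).norm.pow_const 2).aestronglyMeasurable]
    simp only [ENNReal.ofReal_pow (norm_nonneg _), ofReal_norm]
  have hle (a : ℝ × ℝ) : F a ≤ B / Real.pi := by
    rw [hF]
    exact ENNReal.toReal_le_of_le_ofReal (by positivity)
      (lintegral_periodizedKernel_sq_le hB hL hBL a)
  have hnn (a : ℝ × ℝ) : 0 ≤ F a := integral_nonneg fun b => by positivity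
  rcases eq_or_ne (volume S) ⊤ with hinf | hfin
  · -- On a set of infinite measure `F` is bounded away from zero, hence not integrable.
    obtain ⟨c, hc, hlow⟩ := exists_pos_le_lintegral_periodizedKernel_sq hB hL hBL
    have hni : ¬ IntegrableOn F S := by
      intro hi
      refine (hi.measure_ge_lt_top hc).ne (top_le_iff.1 ?_)
      rw [← hinf, ← Measure.restrict_apply_self volume S]
      refine measure_mono_ae ((ae_restrict_iff' hSm).2 (ae_of_all _ fun a ha _ => ?_))
      change c ≤ F a
      rw [hF]
      exact (ENNReal.ofReal_le_iff_le_toReal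
        ((lintegral_periodizedKernel_sq_le hB hL hBL a).trans_lt ENNReal.ofReal_lt_top).ne).1
        (hlow a (hS ha).2)
    rw [integral_undef hni, hinf]
    simp
  · refine (Real.le_norm_self _).trans
      (norm_setIntegral_le_of_norm_le_const hfin.lt_top fun a _ => ?_)
    rw [Real.norm_of_nonneg (hnn a)]
    exact hle a
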